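/- Under the hypotheses and notation of Lemma 1, the optimal values of the two problems differ by the constant ϱ = N·(t_xᵀQt_x + t_uᵀRt_u) + t_xᵀQ_f t_x: the infimum of J_N(x₀, U) over feasible input sequences U of the original problem P-1 equals ϱ plus the infimum of J̄_N(ι_x(x₀), Ū) over feasible input sequences Ū of the transformed problem P-2. -/

import Mathlib

open Matrix

/-- The trajectory of a controlled discrete-time system `x_{k+1} = Φ(x_k, u_k)`
starting from `x0` under the input sequence `U`. -/
def traj {α β : Type*} (Φ : α → β → α) (x0 : α) (U : ℕ → β) : ℕ → α
  | 0 => x0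
  | k + 1 => Φ (traj Φ x0 U k) (U k)

/-- A semiconjugacy between two controlled systems maps trajectories to trajectories. -/
theorem traj_semiconj {α β γ δ : Type*} {Φ : α → β → α} {Ψ : γ → δ → γ} {φ : α → γ} {ψ : β → δ}
    (h : ∀ x u, Ψ (φ x) (ψ u) = φ (Φ x u)) (x0 : α) (U : ℕ → β) (k : ℕ) :
    traj Ψ (φ x0) (fun i => ψ (U i)) k = φ (traj Φ x0 U k) := by
  induction k with
  | zero => rfl
  | succ k ih => simp only [traj, ih, h]

theorem Matrix.inv_mulVec_mulVec_of_isUnit_det {ι R : Type*} [Fintype ι] [DecidableEq ι]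
    [CommRing R] {P : Matrix ι ι R} (hP : IsUnit P.det) (v : ι → R) : P⁻¹ *ᵥ (P *ᵥ v) = v := by
  rw [mulVec_mulVec, nonsing_inv_mul P hP, one_mulVec]

theorem Matrix.mulVec_inv_mulVec_of_isUnit_det {ι R : Type*} [Fintype ι] [DecidableEq ι]
    [CommRing R] {P : Matrix ι ι R} (hP : IsUnit P.det) (v : ι → R) : P *ᵥ (P⁻¹ *ᵥ v) = v := by
  rw [mulVec_mulVec, mul_nonsing_inv P hP, one_mulVec]

/-- A quadratic form expressed in the affine coordinates `P (x + t)`. -/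
theorem dotProduct_mulVec_eq_affine_mask {ι : Type*} [Fintype ι] [DecidableEq ι]
    {P Q : Matrix ι ι ℝ} (hP : IsUnit P.det) (hQ : Q.IsSymm) (t x : ι → ℝ) :
    x ⬝ᵥ Q *ᵥ x = t ⬝ᵥ Q *ᵥ t + (P *ᵥ (x + t) ⬝ᵥ ((P⁻¹)ᵀ * Q * P⁻¹) *ᵥ (P *ᵥ (x + t)) +
      ((-2 : ℝ) • (P⁻¹)ᵀ *ᵥ (Q *ᵥ t)) ⬝ᵥ P *ᵥ (x + t)) := by
  have transpose_dot (v w : ι → ℝ) : (P⁻¹)ᵀ *ᵥ v ⬝ᵥ w = v ⬝ᵥ P⁻¹ *ᵥ w := by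
    rw [mulVec_transpose, ← dotProduct_mulVec]
  have symm_dot : t ⬝ᵥ Q *ᵥ x = x ⬝ᵥ Q *ᵥ t := by
    rw [dotProduct_comm, dotProduct_mulVec x, ← mulVec_transpose, hQ.eq]
  rw [← mulVec_mulVec, ← mulVec_mulVec, inv_mulVec_mulVec_of_isUnit_det hP, dotProduct_comm (P *ᵥ _),
    transpose_dot, smul_dotProduct, transpose_dot, inv_mulVec_mulVec_of_isUnit_det hP,
    dotProduct_comm (Q *ᵥ _), dotProduct_comm (Q *ᵥ _)]
  simp only [mulVec_add, dotProduct_add, add_dotProduct, symm_dot, smul_eq_mul]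
  ring

/-- Adding a real constant commutes with infima in the extended reals. -/
theorem EReal.sInf_image_coe_add {α : Type*} (c : ℝ) (h : α → EReal) (S : Set α) :
    sInf ((fun a => (c : EReal) + h a) '' S) = c + sInf (h '' S) := by
  have cancel (a b : ℝ) (hab : a + b = 0) (x : EReal) : (a : EReal) + (b + x) = x := by
    rw [← add_assoc, ← EReal.coe_add, hab, EReal.coe_zero, zero_add]
  have gc : GaloisConnection (fun x : EReal => ((-c : ℝ) : EReal) + x)
      (fun x : EReal => (c : EReal) + x) := fun x y =>
    ⟨fun hxy => by simpa only [cancel c (-c) (by ring)] using add_le_add_right hxy (c : EReal),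
      fun hxy => by
        simpa only [cancel (-c) c (by ring)] using add_le_add_right hxy ((-c : ℝ) : EReal)⟩
  rw [gc.u_sInf, sInf_image, iInf_image]

/-- The optimal values of the original problem P-1 and the
transformed problem P-2 differ by the constant
`ϱ = N(t_xᵀQt_x + t_uᵀRt_u) + t_xᵀQ_f t_x`: the infimum (in the extended
reals) of `J_N` over the feasible set of P-1 equals `ϱ` plus the infimum of
`J̄_N` over the feasible set of P-2. -/
theorem affine_mask_optimal_value_shift {n m : ℕ} (hn : 1 ≤ n) (hm : 1 ≤ m)
    (N : ℕ) (hN : 1 ≤ N)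
    (f : (Fin n → ℝ) → (Fin n → ℝ))
    (g : (Fin n → ℝ) → Matrix (Fin n) (Fin m) ℝ)
    (Q Qf : Matrix (Fin n) (Fin n) ℝ) (R : Matrix (Fin m) (Fin m) ℝ)
    (hQ : Q.IsSymm) (hQf : Qf.IsSymm) (hR : R.IsSymm)
    (X Xf : Set (Fin n → ℝ)) (Uset : Set (Fin m → ℝ))
    (Px : Matrix (Fin n) (Fin n) ℝ) (Pu : Matrix (Fin m) (Fin m) ℝ)
    (hPx : IsUnit Px.det) (hPu : IsUnit Pu.det)
    (tx : Fin n → ℝ) (tu : Fin m → ℝ) (x0 : Fin n → ℝ)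
    (ιx : (Fin n → ℝ) → (Fin n → ℝ)) (hιx : ∀ x, ιx x = Px.mulVec (x + tx))
    (ιu : (Fin m → ℝ) → (Fin m → ℝ)) (hιu : ∀ u, ιu u = Pu.mulVec (u + tu))
    (ιxinv : (Fin n → ℝ) → (Fin n → ℝ))
    (hιxinv : ∀ xb, ιxinv xb = Px⁻¹.mulVec xb - tx)
    (fbar : (Fin n → ℝ) → (Fin n → ℝ))
    (hfbar : ∀ xb, fbar xb =
      Px.mulVec (f (ιxinv xb) - (g (ιxinv xb)).mulVec tu + tx))
    (gbar : (Fin n → ℝ) → Matrix (Fin n) (Fin m) ℝ)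
    (hgbar : ∀ xb, gbar xb = Px * g (ιxinv xb) * Pu⁻¹)
    (Qbar : Matrix (Fin n) (Fin n) ℝ) (hQbar : Qbar = (Px⁻¹)ᵀ * Q * Px⁻¹)
    (qbar : Fin n → ℝ) (hqbar : qbar = (-2 : ℝ) • (Px⁻¹)ᵀ.mulVec (Q.mulVec tx))
    (Rbar : Matrix (Fin m) (Fin m) ℝ) (hRbar : Rbar = (Pu⁻¹)ᵀ * R * Pu⁻¹)
    (rbar : Fin m → ℝ) (hrbar : rbar = (-2 : ℝ) • (Pu⁻¹)ᵀ.mulVec (R.mulVec tu))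
    (Qfbar : Matrix (Fin n) (Fin n) ℝ) (hQfbar : Qfbar = (Px⁻¹)ᵀ * Qf * Px⁻¹)
    (qfbar : Fin n → ℝ)
    (hqfbar : qfbar = (-2 : ℝ) • (Px⁻¹)ᵀ.mulVec (Qf.mulVec tx))
    (J : (ℕ → Fin m → ℝ) → ℝ)
    (hJ : ∀ U, J U =
      (∑ i ∈ Finset.range N,
        (traj (fun x u => f x + (g x).mulVec u) x0 U i ⬝ᵥ
            Q.mulVec (traj (fun x u => f x + (g x).mulVec u) x0 U i) +
          U i ⬝ᵥ R.mulVec (U i))) +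
      traj (fun x u => f x + (g x).mulVec u) x0 U N ⬝ᵥ
        Qf.mulVec (traj (fun x u => f x + (g x).mulVec u) x0 U N))
    (Jbar : (ℕ → Fin m → ℝ) → ℝ)
    (hJbar : ∀ Ub, Jbar Ub =
      (∑ i ∈ Finset.range N,
        (traj (fun xb ub => fbar xb + (gbar xb).mulVec ub) (ιx x0) Ub i ⬝ᵥ
            Qbar.mulVec
              (traj (fun xb ub => fbar xb + (gbar xb).mulVec ub) (ιx x0) Ub i) +
          qbar ⬝ᵥ traj (fun xb ub => fbar xb + (gbar xb).mulVec ub) (ιx x0) Ub i +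
          Ub i ⬝ᵥ Rbar.mulVec (Ub i) + rbar ⬝ᵥ Ub i)) +
      traj (fun xb ub => fbar xb + (gbar xb).mulVec ub) (ιx x0) Ub N ⬝ᵥ
        Qfbar.mulVec
          (traj (fun xb ub => fbar xb + (gbar xb).mulVec ub) (ιx x0) Ub N) +
      qfbar ⬝ᵥ traj (fun xb ub => fbar xb + (gbar xb).mulVec ub) (ιx x0) Ub N)
    (Feas1 : Set (ℕ → Fin m → ℝ))
    (hFeas1 : Feas1 = {U |
      (∀ i < N, traj (fun x u => f x + (g x).mulVec u) x0 U i ∈ X) ∧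
      (∀ i < N, U i ∈ Uset) ∧
      traj (fun x u => f x + (g x).mulVec u) x0 U N ∈ Xf})
    (Feas2 : Set (ℕ → Fin m → ℝ))
    (hFeas2 : Feas2 = {Ub |
      (∀ i < N,
        traj (fun xb ub => fbar xb + (gbar xb).mulVec ub) (ιx x0) Ub i ∈ ιx '' X) ∧
      (∀ i < N, Ub i ∈ ιu '' Uset) ∧
      traj (fun xb ub => fbar xb + (gbar xb).mulVec ub) (ιx x0) Ub N ∈ ιx '' Xf})
    :
    sInf ((fun U => ((J U : ℝ) : EReal)) '' Feas1) =
      (((N : ℝ) * (tx ⬝ᵥ Q.mulVec tx + tu ⬝ᵥ R.mulVec tu) +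
          tx ⬝ᵥ Qf.mulVec tx : ℝ) : EReal) +
        sInf ((fun Ub => ((Jbar Ub : ℝ) : EReal)) '' Feas2) := by
  have semiconj (x : Fin n → ℝ) (u : Fin m → ℝ) :
      fbar (ιx x) + (gbar (ιx x)).mulVec (ιu u) = ιx (f x + (g x).mulVec u) := by
    have left_inv : ιxinv (ιx x) = x := by
      rw [hιxinv, hιx, inv_mulVec_mulVec_of_isUnit_det hPx, add_sub_cancel_right]
    rw [hfbar, hgbar, left_inv, hιu, ← mulVec_mulVec, ← mulVec_mulVec,
      inv_mulVec_mulVec_of_isUnit_det hPu, hιx, ← mulVec_add, mulVec_add (g x)]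
    congr 1
    abel
  have traj_eq (U : ℕ → Fin m → ℝ) (k : ℕ) :=
    traj_semiconj (Φ := fun x u => f x + (g x).mulVec u)
      (Ψ := fun xb ub => fbar xb + (gbar xb).mulVec ub) semiconj x0 U k
  have ιx_injective : Function.Injective ιx := fun x y hxy => by
    rw [hιx, hιx] at hxy
    exact add_right_cancel (mulVec_injective_of_isUnit ((isUnit_iff_isUnit_det Px).2 hPx) hxy)
  have ιu_injective : Function.Injective ιu := fun x y hxy => by
    rw [hιu, hιu] at hxy
    exact add_right_cancel (mulVec_injective_of_isUnit ((isUnit_iff_isUnit_det Pu).2 hPu) hxy)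
  have ιu_surjective : Function.Surjective ιu := fun v =>
    ⟨Pu⁻¹ *ᵥ v - tu, by rw [hιu, sub_add_cancel, mulVec_inv_mulVec_of_isUnit_det hPu]⟩
  have feas_iff (U : ℕ → Fin m → ℝ) : (fun i => ιu (U i)) ∈ Feas2 ↔ U ∈ Feas1 := by
    simp only [hFeas1, hFeas2, Set.mem_ofPred_eq, traj_eq, ιx_injective.mem_set_image,
      ιu_injective.mem_set_image]
  have feas_eq : Feas2 = (fun U i => ιu (U i)) '' Feas1 := by
    ext V
    obtain ⟨U, rfl⟩ := ιu_surjective.comp_left V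
    constructor
    · exact fun hU => ⟨U, (feas_iff U).1 hU, rfl⟩
    · rintro ⟨W, hW, hWU⟩
      rw [← hWU]
      exact (feas_iff W).2 hW
  have cost_eq (U : ℕ → Fin m → ℝ) :
      J U = ((N : ℝ) * (tx ⬝ᵥ Q.mulVec tx + tu ⬝ᵥ R.mulVec tu) + tx ⬝ᵥ Qf.mulVec tx) +
        Jbar (fun i => ιu (U i)) := by
    have const_sum : (N : ℝ) * (tx ⬝ᵥ Q.mulVec tx + tu ⬝ᵥ R.mulVec tu) =
        ∑ _i ∈ Finset.range N, (tx ⬝ᵥ Q.mulVec tx + tu ⬝ᵥ R.mulVec tu) := by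
      rw [Finset.sum_const, Finset.card_range, nsmul_eq_mul]
    have stage (x : Fin n → ℝ) (u : Fin m → ℝ) :
        x ⬝ᵥ Q.mulVec x + u ⬝ᵥ R.mulVec u =
          (tx ⬝ᵥ Q.mulVec tx + tu ⬝ᵥ R.mulVec tu) +
            (ιx x ⬝ᵥ Qbar.mulVec (ιx x) + qbar ⬝ᵥ ιx x +
              ιu u ⬝ᵥ Rbar.mulVec (ιu u) + rbar ⬝ᵥ ιu u) := by
      rw [dotProduct_mulVec_eq_affine_mask hPx hQ tx x,
        dotProduct_mulVec_eq_affine_mask hPu hR tu u, hιx, hιu, hQbar, hqbar, hRbar, hrbar]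
      ring
    have terminal (x : Fin n → ℝ) : x ⬝ᵥ Qf.mulVec x =
        tx ⬝ᵥ Qf.mulVec tx + (ιx x ⬝ᵥ Qfbar.mulVec (ιx x) + qfbar ⬝ᵥ ιx x) := by
      rw [dotProduct_mulVec_eq_affine_mask hPx hQf tx x, hιx, hQfbar, hqfbar]
    simp only [hJ, hJbar, traj_eq]
    rw [Finset.sum_congr rfl fun i _ => stage _ (U i), Finset.sum_add_distrib, terminal, const_sum]
    ring
  rw [feas_eq, Set.image_image, ← EReal.sInf_image_coe_add]
  simp only [cost_eq, EReal.coe_add]
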